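/- Let $L$ be an invertible Hermitian complex $2n\times 2n$ matrix and $R$ a real unitary matrix with $R^* \bar{L} R = -L$ and $R^2 = 1$. Let $M = R^{1/2}$ be the square root of $R$ with spectrum in $\{1, i\}$. Then $i M L M^*$ is a real antisymmetric invertible matrix, so its Pfaffian is a nonzero real number. -/

import Mathlib

open Matrix

theorem det_pos_of_skew {m : ℕ} (A : Matrix (Fin m) (Fin m) ℝ) (hA : Aᵀ = -A)
    (hd : A.det ≠ 0) : 0 < (-A).det := by
  rcases Nat.eq_zero_or_pos m with rfl | hm
  · simp
  have : NeZero m := ⟨hm.ne'⟩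
  have hroot : ∀ s : ℝ, 0 ≤ s → A.charpoly.eval s ≠ 0 := by
    intro s hs h
    rw [Matrix.eval_charpoly] at h
    obtain ⟨v, hv, hv0⟩ := Matrix.exists_mulVec_eq_zero_iff.mpr h
    have hAv : A *ᵥ v = s • v := by
      rw [Matrix.sub_mulVec, sub_eq_zero] at hv0
      rw [← hv0]
      simp
    have h1 : v ⬝ᵥ (A *ᵥ v) = 0 := by
      have h2 : v ⬝ᵥ (A *ᵥ v) = -(v ⬝ᵥ (A *ᵥ v)) := by
        conv_lhs => rw [Matrix.dotProduct_mulVec, ← Matrix.mulVec_transpose, hA,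
          Matrix.neg_mulVec, neg_dotProduct, dotProduct_comm]
      linarith
    rw [hAv, dotProduct_smul, smul_eq_mul, mul_eq_zero] at h1
    rcases h1 with h1 | h1
    · subst h1
      rw [zero_smul] at hAv
      exact hd (Matrix.exists_mulVec_eq_zero_iff.mp ⟨v, hv, hAv⟩)
    · exact hv (dotProduct_self_eq_zero.mp h1)
  have h0 : (-A).det = A.charpoly.eval 0 := by
    rw [Matrix.eval_charpoly]; simp
  rw [h0]
  by_contra hneg
  push Not at hneg
  have hmon := A.charpoly_monic
  have ht : Filter.Tendsto (fun x => A.charpoly.eval x) Filter.atTop Filter.atTop := by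
    apply Polynomial.tendsto_atTop_of_leadingCoeff_nonneg
    · rw [Matrix.charpoly_degree_eq_dim]; simpa using hm
    · rw [hmon.leadingCoeff]; exact zero_le_one
  obtain ⟨b, hb, hb0⟩ := ((ht.eventually_ge_atTop 0).and (Filter.eventually_ge_atTop 0)).exists
  obtain ⟨c, hc, hc0⟩ := intermediate_value_Icc hb0 A.charpoly.continuous.continuousOn ⟨hneg, hb⟩
  exact hroot c hc.1 hc0

/-- Let `L` be an invertible Hermitian `2n × 2n` complex matrix and `R` a real unitary
matrix with `R^* L̄ R = -L` and `R² = 1`.  Let `M = R^{1/2}` be the square root of `R`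
with spectrum in `{1, i}` (a unitary matrix with `M² = R`).  Then `i M L M^*` is a real
antisymmetric invertible matrix; in particular its Pfaffian is a nonzero real number
(a real number whose square is the determinant). -/
theorem pfaffian_case {n : ℕ} (L R M : Matrix (Fin (2 * n)) (Fin (2 * n)) ℂ)
    (hL : L.IsHermitian) (hLinv : IsUnit L)
    (hR : R ∈ Matrix.unitaryGroup (Fin (2 * n)) ℂ) (hRreal : R.map (starRingEnd ℂ) = R)
    (hsym : Rᴴ * L.map (starRingEnd ℂ) * R = -L) (hR2 : R * R = 1)
    (hM : M ∈ Matrix.unitaryGroup (Fin (2 * n)) ℂ) (hM2 : M * M = R)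
    (hMspec : spectrum ℂ M ⊆ {1, Complex.I}) :
    (Complex.I • (M * L * Mᴴ)).map (starRingEnd ℂ) = Complex.I • (M * L * Mᴴ) ∧
    (Complex.I • (M * L * Mᴴ))ᵀ = -(Complex.I • (M * L * Mᴴ)) ∧
    IsUnit (Complex.I • (M * L * Mᴴ)) ∧
    ∃ p : ℝ, p ≠ 0 ∧ ((p : ℂ)) ^ 2 = (Complex.I • (M * L * Mᴴ)).det := by
  have hMM : Mᴴ * M = 1 := Matrix.mem_unitaryGroup_iff'.mp hM
  have hMM' : M * Mᴴ = 1 := Matrix.mem_unitaryGroup_iff.mp hM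
  have hRR : Rᴴ * R = 1 := Matrix.mem_unitaryGroup_iff'.mp hR
  have hRH : Rᴴ = R := by
    calc Rᴴ = Rᴴ * (R * R) := by rw [hR2, mul_one]
      _ = R := by rw [← mul_assoc, hRR, one_mul]
  have hII : Complex.I * Complex.I = -1 := Complex.I_mul_I
  have hu : ∀ z : ℂ, z ∉ ({1, Complex.I} : Set ℂ) →
      IsUnit (M - algebraMap ℂ (Matrix (Fin (2 * n)) (Fin (2 * n)) ℂ) z) := by
    intro z hz
    have h1 := spectrum.notMem_iff.mp (fun h => hz (hMspec h))
    rw [← IsUnit.neg_iff, neg_sub]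
    exact h1
  have hu1 := hu (-1) (by
    rintro (h | h)
    · norm_num at h
    · have := congrArg Complex.re h; simp at this)
  have hu2 := hu (-Complex.I) (by
    rintro (h | h)
    · have := congrArg Complex.re h; simp at this
    · have := congrArg Complex.im h; norm_num at this)
  have hM4 : M * M * (M * M) = 1 := by rw [hM2, hR2]
  set J := algebraMap ℂ (Matrix (Fin (2 * n)) (Fin (2 * n)) ℂ) Complex.I with hJ
  have hJJ : J * J = -1 := by rw [hJ, ← map_mul, hII]; simp
  have hJM : ∀ X, J * X = X * J := fun X => Algebra.commutes _ _
  rw [map_neg, map_one, sub_neg_eq_add] at hu1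
  rw [map_neg, sub_neg_eq_add] at hu2
  have hfac : (M - 1) * (M - J) * ((M + J) * (M + 1)) = 0 := by
    have e1 : (M - J) * (M + J) = M * M + 1 := by
      rw [sub_mul, mul_add, mul_add, hJJ, hJM M]; abel
    calc (M - 1) * (M - J) * ((M + J) * (M + 1))
        = (M - 1) * ((M - J) * (M + J)) * (M + 1) := by simp only [mul_assoc]
      _ = M * M * (M * M) - 1 := by rw [e1]; noncomm_ring
      _ = 0 := by rw [hM4, sub_self]
  have hq : (M - 1) * (M - J) = 0 := (hu2.mul hu1).mul_left_eq_zero.mp hfac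
  have hMR : (1 + Complex.I) • M = R + Complex.I • (1 : Matrix (Fin (2 * n)) (Fin (2 * n)) ℂ) := by
    have e : J = Complex.I • (1 : Matrix (Fin (2 * n)) (Fin (2 * n)) ℂ) :=
      Algebra.algebraMap_eq_smul_one _
    rw [e, sub_mul, mul_sub, mul_sub, hM2, mul_smul_comm, mul_one, one_mul, one_mul] at hq
    rw [add_smul, one_smul, ← sub_eq_zero, ← neg_eq_zero, ← hq]
    abel
  have hRT : Rᵀ = R := by
    conv_lhs => rw [← hRreal]
    exact hRH
  have hI1 : (1 + Complex.I) ≠ 0 := by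
    intro h; have := congrArg Complex.re h; simp at this
  have hMT : Mᵀ = M := by
    have h := congrArg Matrix.transpose hMR
    rw [Matrix.transpose_smul, Matrix.transpose_add, Matrix.transpose_smul,
      Matrix.transpose_one, hRT, ← hMR] at h
    exact smul_right_injective _ hI1 h
  have hMc : M.map (starRingEnd ℂ) = Mᴴ := by
    conv_rhs => rw [← hMT]
    rfl
  have hMc' : Mᴴ.map (starRingEnd ℂ) = M := by
    rw [← hMc]; ext i j; simp
  have hLc : L.map (starRingEnd ℂ) = -(R * L * R) := by
    rw [hRH] at hsym
    calc L.map (starRingEnd ℂ) = (R * R) * L.map (starRingEnd ℂ) * (R * R) := by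
          rw [hR2, one_mul, mul_one]
      _ = R * (R * L.map (starRingEnd ℂ) * R) * R := by simp only [mul_assoc]
      _ = _ := by rw [hsym]; simp
  have hMhR : Mᴴ * R = M := by rw [← hM2, ← mul_assoc, hMM, one_mul]
  have hRM : R * M = Mᴴ := by
    calc R * M = R * M * (M * Mᴴ) := by rw [hMM', mul_one]
      _ = R * (M * M) * Mᴴ := by simp only [mul_assoc]
      _ = Mᴴ := by rw [hM2, hR2, one_mul]
  have hreal : (Complex.I • (M * L * Mᴴ)).map (starRingEnd ℂ) = Complex.I • (M * L * Mᴴ) := by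
    have e : (Complex.I • (M * L * Mᴴ)).map (starRingEnd ℂ)
        = (-Complex.I) • ((M * L * Mᴴ).map (starRingEnd ℂ)) := by
      ext i j; simp only [Matrix.map_apply, Matrix.smul_apply, smul_eq_mul, map_mul, Complex.conj_I]
    rw [e, Matrix.map_mul, Matrix.map_mul, hMc, hMc', hLc]
    have : Mᴴ * -(R * L * R) * M = -((Mᴴ * R) * L * (R * M)) := by
      simp only [mul_assoc, mul_neg, neg_mul]
    rw [this, hMhR, hRM]
    simp
  have hH : (Complex.I • (M * L * Mᴴ))ᴴ = -(Complex.I • (M * L * Mᴴ)) := by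
    rw [Matrix.conjTranspose_smul, Matrix.conjTranspose_mul, Matrix.conjTranspose_mul,
      Matrix.conjTranspose_conjTranspose, hL.eq, mul_assoc]
    simp
  have hunit : IsUnit (Complex.I • (M * L * Mᴴ)) := by
    have h1 : IsUnit M := ⟨⟨M, Mᴴ, hMM', hMM⟩, rfl⟩
    have h2 : IsUnit Mᴴ := ⟨⟨Mᴴ, M, hMM, hMM'⟩, rfl⟩
    have h3 := (h1.mul hLinv).mul h2
    have h4 : IsUnit (Complex.I • (1 : Matrix (Fin (2 * n)) (Fin (2 * n)) ℂ)) := by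
      rw [← Algebra.algebraMap_eq_smul_one]
      exact (IsUnit.mk0 _ Complex.I_ne_zero).map _
    simpa using h4.mul h3
  generalize Complex.I • (M * L * Mᴴ) = T at hreal hH hunit ⊢
  have hskew : Tᵀ = -T := by
    rw [← hH]
    conv_lhs => rw [← hreal]
    rfl
  refine ⟨hreal, hskew, hunit, ?_⟩
  have hTA : T = (T.map Complex.re).map Complex.ofRealHom := by
    ext i j
    have := congrFun (congrFun hreal i) j
    simpa using (Complex.conj_eq_iff_re.mp this).symm
  have hdet : T.det = (((T.map Complex.re).det : ℝ) : ℂ) := by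
    conv_lhs => rw [hTA]
    exact (RingHom.map_det Complex.ofRealHom (T.map Complex.re)).symm
  have hne : (T.map Complex.re).det ≠ 0 := by
    intro h
    have := (Matrix.isUnit_iff_isUnit_det T).mp hunit
    rw [hdet, h] at this
    simp at this
  have hAs : (T.map Complex.re)ᵀ = -(T.map Complex.re) := by
    ext i j
    have := congrArg Complex.re (congrFun (congrFun hskew i) j)
    simpa using this
  have hpos := det_pos_of_skew _ hAs hne
  rw [Matrix.det_neg, Fintype.card_fin, pow_mul] at hpos
  norm_num at hpos
  refine ⟨Real.sqrt (T.map Complex.re).det, (Real.sqrt_pos.mpr hpos).ne', ?_⟩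
  rw [hdet, ← Complex.ofReal_pow, Real.sq_sqrt hpos.le]
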